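/- arXiv:1201.0743 — 3 statements merged into one kernel-verified Lean document; each statement's English description precedes it below -/
import Mathlib

section
/- Let ρ > 0 and for j = (j₁,j₂) ∈ ℤ² define K̂(j) := (cos(j₂π) e^{i β_{j₁} ρ} − 1) / (√(4πρ) · λ_j) if λ_j ≠ 0, and K̂(j) := (i/(4 j₂)) (ρ/π)^{3/2} if λ_j = 0. Then there exists a constant C > 0 such that |K̂(j)| ≤ C / (1 + (j₁+α)² + (j₂ π/ρ)²) for all j ∈ ℤ². -/
open MeasureTheory

/-- `β_n = (k² − (n+α)²)^{1/2}`, the principal complex square root: positive real when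
`k² > (n+α)²`, and `i((n+α)² − k²)^{1/2}` when `k² < (n+α)²`. -/
noncomputable def greenBeta (k α : ℝ) (n : ℤ) : ℂ :=
  if k ^ 2 < ((n : ℝ) + α) ^ 2 then
    Complex.I * (Real.sqrt (((n : ℝ) + α) ^ 2 - k ^ 2) : ℂ)
  else (Real.sqrt (k ^ 2 - ((n : ℝ) + α) ^ 2) : ℂ)

/-- The `n`-th term `(1/β_n) exp(i α_n x₁ + i β_n |x₂|)` of the series for `G_{k,α}`. -/
noncomputable def greenTerm (k α : ℝ) (n : ℤ) (x : ℝ × ℝ) : ℂ :=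
  (1 / greenBeta k α n) *
    Complex.exp (Complex.I * ((((n : ℝ) + α) * x.1 : ℝ) : ℂ) +
      Complex.I * greenBeta k α n * ((|x.2| : ℝ) : ℂ))

/-- The quasi-periodic Green's function `G_{k,α}(x) = (i/(4π)) Σ_{n∈ℤ} greenTerm k α n x`. -/
noncomputable def greenFun (k α : ℝ) (x : ℝ × ℝ) : ℂ :=
  (Complex.I / (4 * (Real.pi : ℂ))) * ∑' n : ℤ, greenTerm k α n x

/-- The orthonormal trigonometric polynomials
`φ_j(x) = (4πρ)^{−1/2} exp(i((j₁+α)x₁ + (j₂π/ρ)x₂))`. -/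
noncomputable def phiFun (α ρ : ℝ) (j : ℤ × ℤ) (x : ℝ × ℝ) : ℂ :=
  (1 / (Real.sqrt (4 * Real.pi * ρ) : ℂ)) *
    Complex.exp (Complex.I *
      (((((j.1 : ℝ) + α) * x.1) + ((j.2 : ℝ) * Real.pi / ρ) * x.2 : ℝ) : ℂ))

/-- `λ_j = k² − (j₁+α)² − (j₂π/ρ)²`. -/
noncomputable def lamFun (k α ρ : ℝ) (j : ℤ × ℤ) : ℝ :=
  k ^ 2 - ((j.1 : ℝ) + α) ^ 2 - ((j.2 : ℝ) * Real.pi / ρ) ^ 2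

/-- The period cell `Ω_ρ = (−π,π) × (−ρ,ρ)`. -/
def OmegaRho (ρ : ℝ) : Set (ℝ × ℝ) := Set.Ioo (-Real.pi) Real.pi ×ˢ Set.Ioo (-ρ) ρ

/-- The Fourier coefficients `K̂(j)` of the periodized Green's function kernel `𝒦_ρ`. -/
noncomputable def KhatFun (k α ρ : ℝ) (j : ℤ × ℤ) : ℂ :=
  if lamFun k α ρ j ≠ 0 then
    ((Real.cos ((j.2 : ℝ) * Real.pi) : ℂ) *
        Complex.exp (Complex.I * greenBeta k α j.1 * (ρ : ℂ)) - 1) /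
      ((Real.sqrt (4 * Real.pi * ρ) : ℂ) * (lamFun k α ρ j : ℂ))
  else (Complex.I / (4 * (j.2 : ℂ))) * (((ρ / Real.pi) ^ (3 / 2 : ℝ) : ℝ) : ℂ)

/-- The exponential `e^{iβ_nρ}` is bounded by one since `Im β_n ≥ 0`. -/
lemma norm_exp_I_mul_greenBeta_le_one (k α : ℝ) (n : ℤ) {ρ : ℝ} (hρ : 0 ≤ ρ) :
    ‖Complex.exp (Complex.I * greenBeta k α n * (ρ : ℂ))‖ ≤ 1 := by
  rw [Complex.norm_exp, Real.exp_le_one_iff]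
  unfold greenBeta
  split_ifs
  · simp only [← mul_assoc, Complex.I_mul_I]
    simpa using mul_nonneg (Real.sqrt_nonneg _) hρ
  · simp

/-- Away from `λ_j = 0` the coefficients are controlled by `|λ_j|⁻¹`. -/
lemma norm_KhatFun_le_of_lamFun_ne_zero {k α ρ : ℝ} (hρ : 0 ≤ ρ) {j : ℤ × ℤ}
    (hj : lamFun k α ρ j ≠ 0) :
    ‖KhatFun k α ρ j‖ ≤ 2 / (Real.sqrt (4 * Real.pi * ρ) * |lamFun k α ρ j|) := by
  rw [KhatFun, if_pos hj, norm_div, norm_mul, Complex.norm_real, Complex.norm_real,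
    Real.norm_of_nonneg (Real.sqrt_nonneg _), Real.norm_eq_abs]
  gcongr
  refine (norm_sub_le _ _).trans ?_
  rw [norm_mul, Complex.norm_real, norm_one, Real.norm_eq_abs]
  have := mul_le_mul (Real.abs_cos_le_one ((j.2 : ℝ) * Real.pi))
    (norm_exp_I_mul_greenBeta_le_one k α j.1 hρ) (norm_nonneg _) zero_le_one
  linarith

/-- Only finitely many shifted lattice points lie in a given disc. -/
lemma finite_setOf_lattice_sq_add_sq_le (α R : ℝ) {ρ : ℝ} (hρ : 0 < ρ) :
    {j : ℤ × ℤ | ((j.1 : ℝ) + α) ^ 2 + ((j.2 : ℝ) * Real.pi / ρ) ^ 2 ≤ R}.Finite := by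
  refine ((Set.finite_Icc ⌈-√R - α⌉ ⌊√R - α⌋).prod
    (Set.finite_Icc ⌈-√R * ρ / Real.pi⌉ ⌊√R * ρ / Real.pi⌋)).subset ?_
  rintro ⟨m, n⟩ h
  simp only [Set.mem_ofPred_eq] at h
  have hm : |(m : ℝ) + α| ≤ √R := Real.abs_le_sqrt (by nlinarith [sq_nonneg (n * Real.pi / ρ)])
  have hn : |(n : ℝ) * Real.pi / ρ| ≤ √R := Real.abs_le_sqrt (by nlinarith [sq_nonneg (m + α)])
  rw [abs_le] at hm hn
  rw [le_div_iff₀ hρ, div_le_iff₀ hρ] at hn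
  simp only [Set.mem_prod, Set.mem_Icc, Int.ceil_le, Int.le_floor, le_div_iff₀ Real.pi_pos,
    div_le_iff₀ Real.pi_pos]
  exact ⟨⟨by linarith, by linarith⟩, hn⟩

/-- The Fourier coefficients of the periodized kernel decay quadratically:
`|K̂(j)| ≤ C / (1 + (j₁+α)² + (j₂π/ρ)²)`. -/
theorem Khat_quadratic_decay
    (k α : ℝ) (hk : 0 < k)
    (hres : ∀ n : ℤ, k ^ 2 ≠ ((n : ℝ) + α) ^ 2)
    (ρ : ℝ) (hρ : 0 < ρ) :
    ∃ C : ℝ, 0 < C ∧ ∀ j : ℤ × ℤ,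
      ‖KhatFun k α ρ j‖ ≤ C / (1 + ((j.1 : ℝ) + α) ^ 2 + ((j.2 : ℝ) * Real.pi / ρ) ^ 2) := by
  set w : ℤ × ℤ → ℝ := fun j => 1 + ((j.1 : ℝ) + α) ^ 2 + ((j.2 : ℝ) * Real.pi / ρ) ^ 2 with hw
  have hw_pos : ∀ j, 0 < w j := fun j => by positivity
  have hfin := finite_setOf_lattice_sq_add_sq_le α (2 * k ^ 2 + 1) hρ
  have hsqrt : 0 < √(4 * Real.pi * ρ) := by positivity
  have hterm : ∀ j ∈ hfin.toFinset, 0 ≤ ‖KhatFun k α ρ j‖ * w j :=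
    fun j _ => mul_nonneg (norm_nonneg _) (hw_pos j).le
  refine ⟨4 / √(4 * Real.pi * ρ) + ∑ j ∈ hfin.toFinset, ‖KhatFun k α ρ j‖ * w j,
    add_pos_of_pos_of_nonneg (by positivity) (Finset.sum_nonneg hterm), fun j => ?_⟩
  change _ ≤ _ / w j
  rw [le_div_iff₀ (hw_pos j)]
  by_cases hj : j ∈ hfin.toFinset
  · exact (Finset.single_le_sum hterm hj).trans (le_add_of_nonneg_left (by positivity))
  · refine le_trans ?_ (le_add_of_nonneg_right (Finset.sum_nonneg hterm))
    rw [Set.Finite.mem_toFinset, Set.mem_ofPred_eq, not_le] at hj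
    have hneg : lamFun k α ρ j < 0 := by
      unfold lamFun
      nlinarith [sq_nonneg k]
    have hlow : w j ≤ 2 * |lamFun k α ρ j| := by
      rw [abs_of_neg hneg]
      simp only [lamFun, hw]
      linarith
    have hlam : 0 < |lamFun k α ρ j| := abs_pos.mpr hneg.ne
    calc ‖KhatFun k α ρ j‖ * w j
        ≤ 2 / (√(4 * Real.pi * ρ) * |lamFun k α ρ j|) * (2 * |lamFun k α ρ j|) :=
          mul_le_mul (norm_KhatFun_le_of_lamFun_ne_zero hρ.le hneg.ne) hlow (hw_pos j).le
            (by positivity)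
      _ = 4 / √(4 * Real.pi * ρ) := by
          field_simp
          norm_num
end

section
/- Fix x₁ ∈ ℝ and let h : (0,∞) → ℂ be defined by h(t) := (i/(4π)) Σ_{n∈ℤ} (1/β_n) exp(i α_n x₁ + i β_n t). Then for every ρ > 0 the function h is differentiable at t = ρ with derivative h'(ρ) = −(1/(4π)) Σ_{n∈ℤ} exp(i β_n ρ) exp(i α_n x₁), where the latter series converges absolutely. -/
open MeasureTheory

lemma summable_exp_neg_mul_abs_int {r : ℝ} (hr : 0 < r) :
    Summable (fun n : ℤ => Real.exp (-(r * |(n : ℝ)|))) := by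
  have h : Summable (fun n : ℕ => Real.exp (-(r * (n : ℝ)))) := by
    have := Real.summable_exp_nat_mul_iff.mpr (neg_lt_zero.mpr hr)
    refine this.congr fun n => ?_
    ring_nf
  refine Summable.of_nat_of_neg ?_ ?_
  · simpa using h
  · simpa using h

lemma greenBeta_im_nonneg (k α : ℝ) (n : ℤ) : 0 ≤ (greenBeta k α n).im := by
  unfold greenBeta
  split_ifs
  · simp [Real.sqrt_nonneg]
  · simp

lemma greenBeta_im_ge {k : ℝ} (hk : 0 ≤ k) (α : ℝ) (n : ℤ) :
    |(n : ℝ)| - (|α| + k) ≤ (greenBeta k α n).im := by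
  have htri : |(n : ℝ)| ≤ |(n : ℝ) + α| + |α| := by
    simpa using abs_sub ((n : ℝ) + α) α
  refine le_trans (b := |(n : ℝ) + α| - k) (by linarith) ?_
  unfold greenBeta
  split_ifs with h
  · have hlt : k < |(n : ℝ) + α| := by simpa [abs_of_nonneg hk] using sq_lt_sq.mp h
    have hle : |(n : ℝ) + α| - k ≤ √(((n : ℝ) + α) ^ 2 - k ^ 2) := by
      apply Real.le_sqrt_of_sq_le
      nlinarith [sq_abs ((n : ℝ) + α)]
    simpa using hle
  · have hle : |(n : ℝ) + α| ≤ k := by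
      simpa [abs_of_nonneg hk] using sq_le_sq.mp (not_lt.mp h)
    simpa using hle

lemma greenBeta_ne_zero {k α : ℝ} {n : ℤ} (h : k ^ 2 ≠ ((n : ℝ) + α) ^ 2) :
    greenBeta k α n ≠ 0 := by
  unfold greenBeta
  split_ifs with hlt
  · have : 0 < √(((n : ℝ) + α) ^ 2 - k ^ 2) := Real.sqrt_pos.mpr (sub_pos.mpr hlt)
    exact mul_ne_zero Complex.I_ne_zero (Complex.ofReal_ne_zero.mpr this.ne')
  · have : 0 < √(k ^ 2 - ((n : ℝ) + α) ^ 2) :=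
      Real.sqrt_pos.mpr (sub_pos.mpr (lt_of_le_of_ne (not_lt.mp hlt) h.symm))
    exact Complex.ofReal_ne_zero.mpr this.ne'

lemma summable_exp_neg_mul_greenBeta_im {k : ℝ} (hk : 0 ≤ k) (α : ℝ) {r : ℝ} (hr : 0 < r) :
    Summable (fun n : ℤ => Real.exp (-(r * (greenBeta k α n).im))) := by
  refine Summable.of_nonneg_of_le (fun n => (Real.exp_pos _).le) (fun n => ?_)
    ((summable_exp_neg_mul_abs_int hr).mul_left (Real.exp (r * (|α| + k))))
  rw [← Real.exp_add, Real.exp_le_exp]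
  nlinarith [greenBeta_im_ge hk α n]

lemma eventually_one_le_norm_greenBeta {k : ℝ} (hk : 0 ≤ k) (α : ℝ) :
    ∀ᶠ n : ℤ in Filter.cofinite, 1 ≤ ‖greenBeta k α n‖ := by
  have h := (summable_exp_neg_mul_greenBeta_im hk α one_pos).tendsto_cofinite_zero
  filter_upwards [h.eventually_lt_const (Real.exp_pos (-1))] with n hn
  rw [Real.exp_lt_exp] at hn
  have := (le_abs_self _).trans (Complex.abs_im_le_norm (greenBeta k α n))
  linarith

lemma norm_exp_I_mul_ofReal_add (a t : ℝ) (β : ℂ) :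
    ‖Complex.exp (Complex.I * (a : ℂ) + Complex.I * β * (t : ℂ))‖ = Real.exp (-(t * β.im)) := by
  rw [Complex.norm_exp]
  simp [mul_comm]

/-- For fixed `x₁`, the function `h(t) = (i/(4π)) Σ_n (1/β_n) e^{iα_n x₁ + iβ_n t}`
is differentiable at every `ρ > 0` with derivative
`h'(ρ) = −(1/(4π)) Σ_n e^{iβ_n ρ} e^{iα_n x₁}`, the latter series converging absolutely. -/
theorem green_slice_hasDerivAt
    (k α x₁ : ℝ) (hk : 0 < k)
    (hres : ∀ n : ℤ, k ^ 2 ≠ ((n : ℝ) + α) ^ 2)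
    (ρ : ℝ) (hρ : 0 < ρ) :
    HasDerivAt
      (fun t : ℝ =>
        (Complex.I / (4 * (Real.pi : ℂ))) * ∑' n : ℤ,
          (1 / greenBeta k α n) *
            Complex.exp (Complex.I * ((((n : ℝ) + α) * x₁ : ℝ) : ℂ) +
              Complex.I * greenBeta k α n * (t : ℂ)))
      (-(1 / (4 * (Real.pi : ℂ))) * ∑' n : ℤ,
        Complex.exp (Complex.I * greenBeta k α n * (ρ : ℂ)) *
          Complex.exp (Complex.I * ((((n : ℝ) + α) * x₁ : ℝ) : ℂ))) ρ ∧
    Summable (fun n : ℤ =>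
      ‖Complex.exp (Complex.I * greenBeta k α n * (ρ : ℂ)) *
        Complex.exp (Complex.I * ((((n : ℝ) + α) * x₁ : ℝ) : ℂ))‖) := by
  have hcomm : ∀ (n : ℤ) (t : ℝ), Complex.exp (Complex.I * greenBeta k α n * (t : ℂ)) *
      Complex.exp (Complex.I * ((((n : ℝ) + α) * x₁ : ℝ) : ℂ)) =
      Complex.exp (Complex.I * ((((n : ℝ) + α) * x₁ : ℝ) : ℂ) +
        Complex.I * greenBeta k α n * (t : ℂ)) := fun n t => by
    rw [← Complex.exp_add, add_comm]
  simp only [hcomm]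
  refine ⟨?_, ?_⟩
  · have hsum : Summable (fun n : ℤ => (1 / greenBeta k α n) *
        Complex.exp (Complex.I * ((((n : ℝ) + α) * x₁ : ℝ) : ℂ) +
          Complex.I * greenBeta k α n * (ρ : ℂ))) := by
      refine Summable.of_norm_bounded_eventually
        (summable_exp_neg_mul_greenBeta_im hk.le α hρ) ?_
      filter_upwards [eventually_one_le_norm_greenBeta hk.le α] with n hn
      rw [norm_mul, norm_exp_I_mul_ofReal_add, norm_div, norm_one]
      exact mul_le_of_le_one_left (Real.exp_pos _).le
        (div_le_one_of_le₀ hn (norm_nonneg _))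
    have hderiv := hasDerivAt_tsum_of_isPreconnected
      (g := fun (n : ℤ) (t : ℝ) => (1 / greenBeta k α n) *
        Complex.exp (Complex.I * ((((n : ℝ) + α) * x₁ : ℝ) : ℂ) +
          Complex.I * greenBeta k α n * (t : ℂ)))
      (g' := fun (n : ℤ) (t : ℝ) => Complex.I *
        Complex.exp (Complex.I * ((((n : ℝ) + α) * x₁ : ℝ) : ℂ) +
          Complex.I * greenBeta k α n * (t : ℂ)))
      (summable_exp_neg_mul_greenBeta_im hk.le α (half_pos hρ))
      (isOpen_Ioi (a := ρ / 2)) isPreconnected_Ioi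
      (fun n t _ => by
        have hβ := greenBeta_ne_zero (hres n)
        have hlin := (((Complex.ofRealCLM.hasDerivAt (x := t)).const_mul
          (Complex.I * greenBeta k α n)).const_add
          (Complex.I * ((((n : ℝ) + α) * x₁ : ℝ) : ℂ))).cexp.const_mul (1 / greenBeta k α n)
        refine hlin.congr_deriv ?_
        simp only [Complex.ofRealCLM_apply, Complex.ofReal_one]
        field_simp)
      (fun n t ht => by
        rw [norm_mul, Complex.norm_I, one_mul, norm_exp_I_mul_ofReal_add, Real.exp_le_exp]
        exact neg_le_neg (mul_le_mul_of_nonneg_right (le_of_lt ht) (greenBeta_im_nonneg k α n)))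
      (half_lt_self hρ) hsum (half_lt_self hρ)
    refine (hderiv.const_mul (Complex.I / (4 * (Real.pi : ℂ)))).congr_deriv ?_
    rw [tsum_mul_left, ← mul_assoc, div_mul_eq_mul_div, Complex.I_mul_I, neg_div]
  · simp only [norm_exp_I_mul_ofReal_add]
    exact summable_exp_neg_mul_greenBeta_im hk.le α hρ
end

section
/- Let Q be a complex 2×2 matrix and set Re(Q) := (Q + Q*)/2 and Im(Q) := (Q − Q*)/(2i), where Q* is the conjugate transpose; both are Hermitian. Let |Re(Q)| denote the unique positive semidefinite matrix whose square is (Re(Q))², and let |Re(Q)|^{1/2} be its positive semidefinite square root. Suppose C ≥ 0 is such that ‖Im(Q) ξ‖ ≤ C ‖Re(Q) ξ‖ for all ξ ∈ ℂ². Then for all ξ ∈ ℂ²: ‖Q ξ‖ ≤ (1 + C) · ‖|Re(Q)|^{1/2}‖₂ · ‖|Re(Q)|^{1/2} ξ‖, where ‖·‖ is the Euclidean norm on ℂ² and ‖·‖₂ is the spectral (operator) norm of a matrix. -/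
open Matrix
open scoped ComplexOrder

/-- Operators with the same Gram operator have the same pointwise norm. -/
theorem ContinuousLinearMap.norm_apply_eq_of_star_mul_self_eq {𝕜 E : Type*} [RCLike 𝕜]
    [NormedAddCommGroup E] [InnerProductSpace 𝕜 E] [CompleteSpace E] {A B : E →L[𝕜] E}
    (h : star A * A = star B * B) (x : E) : ‖A x‖ = ‖B x‖ := by
  rw [ContinuousLinearMap.apply_norm_eq_sqrt_inner_adjoint_left A,
    ContinuousLinearMap.apply_norm_eq_sqrt_inner_adjoint_left B]
  exact congrArg (fun T : E →L[𝕜] E => √(RCLike.re (inner 𝕜 (T x) x))) h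

/-- Hermitian matrices with the same square have the same pointwise Euclidean norm. -/
theorem Matrix.IsHermitian.norm_toEuclideanCLM_eq_of_mul_self_eq {𝕜 n : Type*} [RCLike 𝕜]
    [Fintype n] [DecidableEq n] {A B : Matrix n n 𝕜} (hA : A.IsHermitian) (hB : B.IsHermitian)
    (h : A * A = B * B) (x : EuclideanSpace 𝕜 n) :
    ‖toEuclideanCLM (𝕜 := 𝕜) A x‖ = ‖toEuclideanCLM (𝕜 := 𝕜) B x‖ := by
  refine ContinuousLinearMap.norm_apply_eq_of_star_mul_self_eq ?_ x
  rw [← map_star, ← map_star, ← map_mul, ← map_mul, star_eq_conjTranspose,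
    star_eq_conjTranspose, hA.eq, hB.eq, h]

/-- Let `Q` be a complex `2×2` matrix with real part `Re(Q) = (Q+Q*)/2` and
imaginary part `Im(Q) = (Q−Q*)/(2i)`. Let `R = |Re(Q)|` be the unique positive semidefinite
matrix with `R² = (Re Q)²`, and let `S = |Re(Q)|^{1/2}` be its positive semidefinite square root.
If `‖Im(Q)ξ‖ ≤ C ‖Re(Q)ξ‖` for all `ξ ∈ ℂ²`, then
`‖Qξ‖ ≤ (1+C) ‖S‖₂ ‖Sξ‖` for all `ξ ∈ ℂ²`, where `‖·‖` is the Euclidean norm and `‖·‖₂` the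
spectral norm. -/
theorem matrix_bound_via_sqrt_abs_re
    (Q R S : Matrix (Fin 2) (Fin 2) ℂ) (C : ℝ) (hC : 0 ≤ C)
    (hR : R.PosSemidef)
    (hR2 : R * R = ((2 : ℂ)⁻¹ • (Q + Qᴴ)) * ((2 : ℂ)⁻¹ • (Q + Qᴴ)))
    (hS : S.PosSemidef) (hS2 : S * S = R)
    (hIm : ∀ ξ : EuclideanSpace ℂ (Fin 2),
      ‖toEuclideanCLM (𝕜 := ℂ) ((2 * Complex.I)⁻¹ • (Q - Qᴴ)) ξ‖ ≤
        C * ‖toEuclideanCLM (𝕜 := ℂ) ((2 : ℂ)⁻¹ • (Q + Qᴴ)) ξ‖) :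
    ∀ ξ : EuclideanSpace ℂ (Fin 2),
      ‖toEuclideanCLM (𝕜 := ℂ) Q ξ‖ ≤
        (1 + C) * ‖toEuclideanCLM (𝕜 := ℂ) S‖ * ‖toEuclideanCLM (𝕜 := ℂ) S ξ‖ := by
  intro ξ
  set H : Matrix (Fin 2) (Fin 2) ℂ := (2 : ℂ)⁻¹ • (Q + Qᴴ) with hH
  set K : Matrix (Fin 2) (Fin 2) ℂ := (2 * Complex.I)⁻¹ • (Q - Qᴴ) with hK
  have hHherm : H.IsHermitian := by
    simp [IsHermitian, hH, conjTranspose_smul, add_comm]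
  have hQ : Q = H + Complex.I • K := by
    ext i j
    simp only [hH, hK, Matrix.add_apply, Matrix.smul_apply, Matrix.sub_apply, smul_eq_mul]
    field_simp
    ring
  have hHR : ‖toEuclideanCLM (𝕜 := ℂ) H ξ‖ = ‖toEuclideanCLM (𝕜 := ℂ) R ξ‖ :=
    hHherm.norm_toEuclideanCLM_eq_of_mul_self_eq hR.isHermitian hR2.symm ξ
  have hRS : ‖toEuclideanCLM (𝕜 := ℂ) R ξ‖ ≤
      ‖toEuclideanCLM (𝕜 := ℂ) S‖ * ‖toEuclideanCLM (𝕜 := ℂ) S ξ‖ := by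
    rw [← hS2, map_mul]
    exact (toEuclideanCLM (𝕜 := ℂ) S).le_opNorm _
  calc ‖toEuclideanCLM (𝕜 := ℂ) Q ξ‖
      = ‖toEuclideanCLM (𝕜 := ℂ) H ξ + Complex.I • toEuclideanCLM (𝕜 := ℂ) K ξ‖ := by
        conv_lhs => rw [hQ, map_add, map_smul _ Complex.I K]
        rfl
    _ ≤ ‖toEuclideanCLM (𝕜 := ℂ) H ξ‖ + ‖toEuclideanCLM (𝕜 := ℂ) K ξ‖ := by
        refine (norm_add_le _ _).trans_eq ?_
        rw [norm_smul, Complex.norm_I, one_mul]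
    _ ≤ (1 + C) * ‖toEuclideanCLM (𝕜 := ℂ) R ξ‖ := by
        rw [← hHR]
        linarith [hIm ξ]
    _ ≤ (1 + C) * ‖toEuclideanCLM (𝕜 := ℂ) S‖ * ‖toEuclideanCLM (𝕜 := ℂ) S ξ‖ := by
        rw [mul_assoc]
        gcongr
end
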